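/- For every α ∈ (0,1) there exist constants c > 0, C₀ > 0 and C > 0 such that the following holds. Let q be a prime power, n ≥ 1 and m ≥ 1 with m < c·log n and C₀ ≤ log q < c·(αn)^{1/2}/m^{3/2}. Let 𝝁 be an n×n matrix of α-balanced measures on F_q, M ~ M(𝝁), and let λ₁, …, λ_m ∈ F_q be distinct. Then P(λ₁, …, λ_m are all eigenvalues of M) ≤ (q−1)^{−m} + C·exp(−c·(αn)^{1/2}/m^{3/2}). -/

import Mathlib

/- STATEMENT 3: For every α ∈ (0,1) there are constants c, C₀, C > 0 such that if
m < c·log n and C₀ ≤ log q < c·(αn)^{1/2}/m^{3/2}, then for M ~ M(𝝁) with 𝝁 an n×n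
matrix of α-balanced measures on F_q and distinct λ₁, …, λ_m ∈ F_q,
P(all λ_j are eigenvalues of M) ≤ (q−1)^{−m} + C·exp(−c·(αn)^{1/2}/m^{3/2}). -/

open scoped Classical

noncomputable section

/-- `μ` is an `α`-balanced probability measure on the finite additive group `F`:
every coset of a proper subgroup has mass at most `1 - α`. -/
def IsBalanced {F : Type*} [AddCommGroup F] [Fintype F] (α : ℝ) (μ : F → ℝ) : Prop :=
  (∀ x, 0 ≤ μ x) ∧ (∑ x, μ x = 1) ∧
    ∀ (x : F) (H : AddSubgroup F), H ≠ ⊤ →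
      ∑ y ∈ Finset.univ.filter (fun y => y - x ∈ H), μ y ≤ 1 - α

/-- The probability of an event `E` for a random `n × n` matrix over a finite field
with independent entries, the `(i,j)` entry having law `μ i j`. -/
def matProb {F : Type*} [Fintype F] {n : ℕ} (μ : Fin n → Fin n → F → ℝ)
    (E : Set (Matrix (Fin n) (Fin n) F)) : ℝ :=
  ∑ M ∈ Finset.univ.filter (fun M : Matrix (Fin n) (Fin n) F => M ∈ E),
    ∏ i, ∏ j, μ i j (M i j)

namespace RandomMatrix

variable {F : Type*} [Field F] [Fintype F] {ψ : AddChar F ℂ} {α : ℝ} {μ : F → ℝ} {m n : ℕ}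

/-- The Fourier transform of `μ` with respect to the additive character `ψ`. -/
def fourier (ψ : AddChar F ℂ) (μ : F → ℝ) (y : F) : ℂ := ∑ a, (μ a : ℂ) * ψ (a * y)

/-- The loss `1 - |μ̂|²` of the Fourier transform of `μ`. -/
def defect (ψ : AddChar F ℂ) (μ : F → ℝ) (y : F) : ℝ := 1 - ‖fourier ψ μ y‖ ^ 2

lemma sq_norm_fourier (ψ : AddChar F ℂ) (μ : F → ℝ) (y : F) :
    ‖fourier ψ μ y‖ ^ 2 = ∑ a, ∑ b, μ a * μ b * (ψ ((a - b) * y)).re := by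
  have h : ((‖fourier ψ μ y‖ ^ 2 : ℝ) : ℂ) = ∑ a, ∑ b, (μ a * μ b : ℂ) * ψ ((a - b) * y) := by
    push_cast
    rw [← Complex.mul_conj', fourier, map_sum, Finset.sum_mul_sum]
    refine Finset.sum_congr rfl fun a _ => Finset.sum_congr rfl fun b _ => ?_
    rw [map_mul (starRingEnd ℂ), Complex.conj_ofReal, sub_mul, sub_eq_add_neg,
      AddChar.map_add_eq_mul, AddChar.map_neg_eq_conj]
    ring
  have h' := congrArg Complex.re h
  rw [Complex.ofReal_re] at h'
  rw [h', Complex.re_sum]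
  refine Finset.sum_congr rfl fun a _ => ?_
  rw [Complex.re_sum]
  refine Finset.sum_congr rfl fun b _ => ?_
  rw [← Complex.ofReal_mul, Complex.re_ofReal_mul]

lemma sum_sum_mul_eq_one {ι : Type*} [Fintype ι] {μ : ι → ℝ} (h1 : ∑ a, μ a = 1) :
    ∑ a, ∑ b, μ a * μ b = 1 := by
  rw [← Finset.sum_mul_sum, h1, one_mul]

lemma defect_eq_sum (h1 : ∑ a, μ a = 1) (y : F) :
    defect ψ μ y = ∑ a, ∑ b, μ a * μ b * (1 - (ψ ((a - b) * y)).re) := by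
  simp only [mul_sub, mul_one, Finset.sum_sub_distrib]
  rw [defect, sq_norm_fourier, sum_sum_mul_eq_one h1]

lemma defect_le_one (y : F) : defect ψ μ y ≤ 1 := by
  have := sq_nonneg ‖fourier ψ μ y‖
  rw [defect]; linarith

lemma norm_fourier_le_one (h0 : ∀ a, 0 ≤ μ a) (h1 : ∑ a, μ a = 1) (y : F) :
    ‖fourier ψ μ y‖ ≤ 1 := by
  rw [fourier, ← h1]
  refine (norm_sum_le _ _).trans (Finset.sum_le_sum fun a _ => ?_)
  rw [norm_mul, AddChar.norm_apply, mul_one, Complex.norm_real, Real.norm_of_nonneg (h0 a)]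

lemma defect_nonneg (h0 : ∀ a, 0 ≤ μ a) (h1 : ∑ a, μ a = 1) (y : F) : 0 ≤ defect ψ μ y := by
  have := pow_le_one₀ (n := 2) (norm_nonneg _) (norm_fourier_le_one (ψ := ψ) h0 h1 y)
  rw [defect]; linarith

lemma defect_zero (h1 : ∑ a, μ a = 1) : defect ψ μ 0 = 0 := by
  rw [defect_eq_sum h1]; simp

lemma defect_neg (h1 : ∑ a, μ a = 1) (y : F) : defect ψ μ (-y) = defect ψ μ y := by
  rw [defect_eq_sum h1, defect_eq_sum h1]
  simp only [mul_neg, AddChar.map_neg_eq_conj, Complex.conj_re]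

lemma one_sub_re_mul_le {z w : ℂ} (hz : ‖z‖ = 1) (hw : ‖w‖ = 1) :
    1 - (z * w).re ≤ 2 * (1 - z.re) + 2 * (1 - w.re) := by
  have hz' : z.re ^ 2 + z.im ^ 2 = 1 := by
    have := Complex.sq_norm z
    rw [hz, Complex.normSq_apply] at this; nlinarith
  have hw' : w.re ^ 2 + w.im ^ 2 = 1 := by
    have := Complex.sq_norm w
    rw [hw, Complex.normSq_apply] at this; nlinarith
  rw [Complex.mul_re]
  nlinarith [sq_nonneg (z.re + w.re - 2), sq_nonneg (z.im + w.im),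
    sq_nonneg (z.im - w.im), sq_nonneg (z.re - w.re)]

lemma defect_add_le (h0 : ∀ a, 0 ≤ μ a) (h1 : ∑ a, μ a = 1) (y z : F) :
    defect ψ μ (y + z) ≤ 2 * (defect ψ μ y + defect ψ μ z) := by
  simp only [defect_eq_sum h1, Finset.mul_sum, ← Finset.sum_add_distrib]
  refine Finset.sum_le_sum fun a _ => Finset.sum_le_sum fun b _ => ?_
  rw [mul_add (a - b), AddChar.map_add_eq_mul]
  have := one_sub_re_mul_le (AddChar.norm_apply ψ ((a - b) * y))
    (AddChar.norm_apply ψ ((a - b) * z))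
  nlinarith [mul_nonneg (h0 a) (h0 b)]

lemma norm_fourier_le_exp (y : F) : ‖fourier ψ μ y‖ ≤ Real.exp (-(defect ψ μ y) / 2) := by
  have h := Real.add_one_le_exp (-(defect ψ μ y))
  have h2 : ‖fourier ψ μ y‖ ^ 2 ≤ Real.exp (-(defect ψ μ y) / 2) ^ 2 := by
    rw [← Real.exp_nat_mul]
    refine le_trans (le_of_eq ?_) (h.trans (le_of_eq ?_))
    · rw [defect]; ring
    · congr 1; push_cast; ring
  exact le_of_sq_le_sq h2 (Real.exp_pos _).le

lemma sum_mul_ite_mem_le (hμ : IsBalanced α μ) {K : AddSubgroup F} (hK : K ≠ ⊤) :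
    ∑ a, ∑ b, μ a * μ b * (if a - b ∈ K then 1 else 0) ≤ 1 - α := by
  obtain ⟨h0, h1, hb⟩ := hμ
  rw [Finset.sum_comm]
  calc ∑ b, ∑ a, μ a * μ b * (if a - b ∈ K then 1 else 0)
      = ∑ b, μ b * ∑ a ∈ Finset.univ.filter (fun a => a - b ∈ K), μ a := by
        refine Finset.sum_congr rfl fun b _ => ?_
        rw [Finset.sum_filter, Finset.mul_sum]
        refine Finset.sum_congr rfl fun a _ => ?_
        split_ifs <;> ring
    _ ≤ ∑ b, μ b * (1 - α) :=
        Finset.sum_le_sum fun b _ => mul_le_mul_of_nonneg_left (hb b K hK) (h0 b)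
    _ = 1 - α := by rw [← Finset.sum_mul, h1, one_mul]

lemma sum_dotProduct (hψ : ψ.IsPrimitive) (y : Fin m → F) :
    ∑ x : Fin m → F, ψ (x ⬝ᵥ y) = if y = 0 then (Fintype.card (Fin m → F) : ℂ) else 0 := by
  split_ifs with h
  · simp [h]
  obtain ⟨i, hi⟩ := Function.ne_iff.1 h
  let χ : AddChar (Fin m → F) ℂ :=
    { toFun := fun x => ψ (x ⬝ᵥ y)
      map_zero_eq_one' := by simp
      map_add_eq_mul' := fun a b => by rw [add_dotProduct, AddChar.map_add_eq_mul] }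
  have hχ : χ ≠ 0 := by
    intro h0
    refine hψ hi ?_
    ext a
    have := DFunLike.congr_fun h0 (Pi.single i a)
    simpa [χ, AddChar.mulShift_apply, mul_comm] using this
  exact AddChar.sum_eq_zero_iff_ne_zero.2 hχ

lemma sum_subgroup (H : AddSubgroup (Fin m → F)) {T : Finset (Fin m → F)}
    (hT : ∀ h, h ∈ T ↔ h ∈ H) (c : F) (x : Fin m → F) :
    ∑ h ∈ T, ψ (c * (h ⬝ᵥ x)) =
      if ∀ h ∈ H, ψ (c * (h ⬝ᵥ x)) = 1 then (T.card : ℂ) else 0 := by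
  split_ifs with hc
  · rw [Finset.sum_congr rfl fun h hh => hc h ((hT h).1 hh)]; simp
  let χ : AddChar H ℂ :=
    { toFun := fun h => ψ (c * ((h : Fin m → F) ⬝ᵥ x))
      map_zero_eq_one' := by simp
      map_add_eq_mul' := fun a b => by
        simp only [AddSubgroup.coe_add, add_dotProduct, mul_add, AddChar.map_add_eq_mul] }
  have hχ : χ ≠ 0 := by
    intro h0
    refine hc fun h hh => ?_
    simpa [χ] using DFunLike.congr_fun h0 ⟨h, hh⟩
  rw [Finset.sum_subtype T hT]
  exact AddChar.sum_eq_zero_iff_ne_zero.2 hχ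

lemma sum_sq_norm_fourier_le (hψ : ψ.IsPrimitive) (hμ : IsBalanced α μ)
    (H : AddSubgroup (Fin m → F)) {T : Finset (Fin m → F)} (hT : ∀ h, h ∈ T ↔ h ∈ H)
    {x : Fin m → F} (hx : ∃ h ∈ H, h ⬝ᵥ x ≠ 0) :
    ∑ h ∈ T, ‖fourier ψ μ (h ⬝ᵥ x)‖ ^ 2 ≤ (1 - α) * T.card := by
  let K : AddSubgroup F :=
    { carrier := {c | ∀ h ∈ H, ψ (c * (h ⬝ᵥ x)) = 1}
      zero_mem' := fun h _ => by simp
      add_mem' := fun {a b} ha hb h hh => by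
        rw [add_mul, AddChar.map_add_eq_mul, ha h hh, hb h hh, one_mul]
      neg_mem' := fun {a} ha h hh => by
        rw [neg_mul, AddChar.map_neg_eq_conj, ha h hh, map_one] }
  have hK : K ≠ ⊤ := by
    intro hK
    obtain ⟨h, hh, hne⟩ := hx
    refine hψ hne ?_
    ext c
    have hc : c ∈ K := hK ▸ AddSubgroup.mem_top c
    simpa [AddChar.mulShift_apply, mul_comm] using hc h hh
  have key (a b : F) : ∑ h ∈ T, (ψ ((a - b) * (h ⬝ᵥ x))).re =
      T.card * (if a - b ∈ K then 1 else 0) := by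
    rw [← Complex.re_sum, sum_subgroup H hT]
    have : (∀ h ∈ H, ψ ((a - b) * (h ⬝ᵥ x)) = 1) ↔ a - b ∈ K := Iff.rfl
    simp only [this]
    split_ifs <;> simp
  calc ∑ h ∈ T, ‖fourier ψ μ (h ⬝ᵥ x)‖ ^ 2
      = ∑ a, ∑ b, μ a * μ b * ∑ h ∈ T, (ψ ((a - b) * (h ⬝ᵥ x))).re := by
        simp only [sq_norm_fourier, Finset.mul_sum]
        rw [Finset.sum_comm]
        exact Finset.sum_congr rfl fun a _ => Finset.sum_comm
    _ = T.card * ∑ a, ∑ b, μ a * μ b * (if a - b ∈ K then 1 else 0) := by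
        simp only [key, Finset.mul_sum]
        exact Finset.sum_congr rfl fun a _ => Finset.sum_congr rfl fun b _ => by ring
    _ ≤ (1 - α) * T.card := by
        rw [mul_comm]
        exact mul_le_mul_of_nonneg_right (sum_mul_ite_mem_le hμ hK) (Nat.cast_nonneg _)

lemma sum_norm_fourier_le (hα1 : α < 1) (hψ : ψ.IsPrimitive) (hμ : IsBalanced α μ)
    (H : AddSubgroup (Fin m → F)) {T : Finset (Fin m → F)} (hT : ∀ h, h ∈ T ↔ h ∈ H)
    {x : Fin m → F} (hx : ∃ h ∈ H, h ⬝ᵥ x ≠ 0) :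
    ∑ h ∈ T, ‖fourier ψ μ (h ⬝ᵥ x)‖ ≤ (1 - α / 2) * T.card := by
  have h2 := sum_sq_norm_fourier_le hψ hμ H hT hx
  have h3 : ∑ h ∈ T, ‖fourier ψ μ (h ⬝ᵥ x)‖ ≤
      ∑ h ∈ T, (‖fourier ψ μ (h ⬝ᵥ x)‖ ^ 2 + (1 - α / 2) ^ 2) / (2 * (1 - α / 2)) := by
    refine Finset.sum_le_sum fun h _ => ?_
    rw [le_div_iff₀ (by linarith)]
    nlinarith [sq_nonneg (‖fourier ψ μ (h ⬝ᵥ x)‖ - (1 - α / 2))]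
  refine h3.trans ?_
  rw [← Finset.sum_div, Finset.sum_add_distrib, Finset.sum_const, nsmul_eq_mul,
    div_le_iff₀ (by linarith)]
  have hc : (0 : ℝ) ≤ T.card := Nat.cast_nonneg _
  nlinarith [mul_nonneg hc (sq_nonneg α)]

/-- Parseval's identity for the indicator function of `T`. -/
lemma sum_sq_norm_sum_character (hψ : ψ.IsPrimitive) (T : Finset (Fin m → F)) {c : F} (hc : c ≠ 0) :
    ∑ x : Fin m → F, ‖∑ ξ ∈ T, ψ (c * (ξ ⬝ᵥ x))‖ ^ 2 =
      T.card * (Fintype.card (Fin m → F) : ℝ) := by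
  have key (ξ η : Fin m → F) : ∑ x : Fin m → F, ψ (c * (ξ ⬝ᵥ x)) * ψ (-(c * (η ⬝ᵥ x))) =
      if ξ = η then (Fintype.card (Fin m → F) : ℂ) else 0 := by
    have h1 : ∀ x : Fin m → F, ψ (c * (ξ ⬝ᵥ x)) * ψ (-(c * (η ⬝ᵥ x))) =
        ψ (x ⬝ᵥ (c • (ξ - η))) := by
      intro x
      rw [← AddChar.map_add_eq_mul, dotProduct_smul, dotProduct_comm x, sub_dotProduct,
        smul_eq_mul, mul_sub, sub_eq_add_neg]
    rw [Finset.sum_congr rfl fun x _ => h1 x, sum_dotProduct hψ]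
    simp only [smul_eq_zero, hc, false_or, sub_eq_zero]
  have h : ((∑ x : Fin m → F, ‖∑ ξ ∈ T, ψ (c * (ξ ⬝ᵥ x))‖ ^ 2 : ℝ) : ℂ) =
      T.card * (Fintype.card (Fin m → F) : ℂ) := by
    push_cast
    simp only [← Complex.mul_conj', map_sum, Finset.sum_mul_sum, ← AddChar.map_neg_eq_conj]
    rw [Finset.sum_comm]
    simp only [Finset.sum_comm (s := Finset.univ), key]
    rw [Finset.sum_congr rfl fun ξ hξ => Finset.sum_ite_eq T ξ _]
    simp
  exact_mod_cast h

/-- The points `x` at which the defect of `μ` is small on average over `T`. -/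
def approxDual (ψ : AddChar F ℂ) (α : ℝ) (μ : F → ℝ) (T : Finset (Fin m → F)) :
    Finset (Fin m → F) :=
  Finset.univ.filter fun x => ∑ ξ ∈ T, defect ψ μ (ξ ⬝ᵥ x) ≤ α / 2 * T.card

lemma card_approxDual_subgroup (hα0 : 0 < α) (hψ : ψ.IsPrimitive) (hμ : IsBalanced α μ)
    (H : AddSubgroup (Fin m → F)) {T : Finset (Fin m → F)} (hT : ∀ h, h ∈ T ↔ h ∈ H) :
    ((approxDual ψ α μ T).card : ℝ) * T.card ≤ Fintype.card (Fin m → F) := by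
  have hpos : (0 : ℝ) < T.card := by
    exact_mod_cast Finset.card_pos.2 ⟨0, (hT 0).2 H.zero_mem⟩
  have horth : ∀ x ∈ approxDual ψ α μ T, ∀ h ∈ T, h ⬝ᵥ x = 0 := by
    intro x hx
    by_contra! hne
    obtain ⟨h, hh, hne⟩ := hne
    have h2 := sum_sq_norm_fourier_le hψ hμ H hT ⟨h, (hT h).1 hh, hne⟩
    have h3 := (Finset.mem_filter.1 hx).2
    simp only [defect, Finset.sum_sub_distrib, Finset.sum_const, nsmul_eq_mul, mul_one] at h3
    nlinarith
  have hP := sum_sq_norm_sum_character hψ T (one_ne_zero (α := F))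
  have h4 : ∑ x ∈ approxDual ψ α μ T, (T.card : ℝ) ^ 2 ≤
      ∑ x : Fin m → F, ‖∑ ξ ∈ T, ψ (1 * (ξ ⬝ᵥ x))‖ ^ 2 := by
    refine le_trans (Finset.sum_le_sum fun x hx => ?_)
      (Finset.sum_le_sum_of_subset_of_nonneg (Finset.subset_univ _) fun x _ _ => sq_nonneg _)
    rw [Finset.sum_congr rfl fun ξ hξ => by rw [horth x hx ξ hξ]]
    simp
  rw [hP, Finset.sum_const, nsmul_eq_mul] at h4
  refine le_of_mul_le_mul_right ?_ hpos
  nlinarith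

lemma card_approxDual_le (hα0 : 0 < α) (hψ : ψ.IsPrimitive) (hμ : IsBalanced α μ)
    {T : Finset (Fin m → F)} (hT : T.Nonempty) :
    ((approxDual ψ α μ T).card : ℝ) * T.card ≤ 4 * Fintype.card (Fin m → F) := by
  have hpos : (0 : ℝ) < T.card := by exact_mod_cast Finset.card_pos.2 hT
  set S : F → (Fin m → F) → ℂ := fun c x => ∑ ξ ∈ T, ψ (c * (ξ ⬝ᵥ x)) with hS
  set w : F → F → ℝ := fun a b => μ a * μ b * (if a = b then 0 else 1) with hw
  have hw0 : ∀ a b, 0 ≤ w a b := fun a b =>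
    mul_nonneg (mul_nonneg (hμ.1 a) (hμ.1 b)) (by split_ifs <;> norm_num)
  set β : ℝ := ∑ a, ∑ b, w a b with hβ
  have hdiag : ∑ a, ∑ b, μ a * μ b * (if a - b ∈ (⊥ : AddSubgroup F) then 1 else 0) ≤ 1 - α :=
    sum_mul_ite_mem_le hμ bot_ne_top
  simp only [AddSubgroup.mem_bot, sub_eq_zero] at hdiag
  have hsplit : β = 1 - ∑ a, ∑ b, μ a * μ b * (if a = b then 1 else 0) := by
    rw [eq_sub_iff_add_eq, hβ, ← Finset.sum_add_distrib]
    refine Eq.trans (Finset.sum_congr rfl fun a _ => ?_) (sum_sum_mul_eq_one hμ.2.1)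
    rw [← Finset.sum_add_distrib]
    refine Finset.sum_congr rfl fun b _ => ?_
    simp only [hw]
    split_ifs <;> ring
  have hβα : α ≤ β := by linarith
  have hlow : ∀ x ∈ approxDual ψ α μ T,
      β * T.card ^ 2 / 4 ≤ ∑ a, ∑ b, w a b * ‖S (a - b) x‖ ^ 2 := by
    intro x hx
    have h3 := (Finset.mem_filter.1 hx).2
    have h4 : ∑ ξ ∈ T, defect ψ μ (ξ ⬝ᵥ x) = ∑ a, ∑ b, w a b * (T.card - (S (a - b) x).re) := by
      simp only [defect_eq_sum hμ.2.1]
      rw [Finset.sum_comm]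
      refine Finset.sum_congr rfl fun a _ => ?_
      rw [Finset.sum_comm]
      refine Finset.sum_congr rfl fun b _ => ?_
      rw [← Finset.mul_sum]
      simp only [hw, hS]
      split_ifs with hab
      · simp [hab]
      · rw [Finset.sum_sub_distrib, Complex.re_sum]; simp
    have h5 : ∀ a b, w a b * (3 / 4 * T.card - ‖S (a - b) x‖ ^ 2 / T.card) ≤
        w a b * (T.card - (S (a - b) x).re) := by
      intro a b
      refine mul_le_mul_of_nonneg_left ?_ (hw0 a b)
      have h6 := Complex.re_le_norm (S (a - b) x)
      have h7 : ‖S (a - b) x‖ ≤ T.card / 4 + ‖S (a - b) x‖ ^ 2 / T.card := by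
        rw [div_add_div _ _ four_ne_zero hpos.ne', le_div_iff₀ (by positivity)]
        nlinarith [sq_nonneg ((T.card : ℝ) - 2 * ‖S (a - b) x‖)]
      linarith
    have h8 : ∑ a, ∑ b, w a b * (3 / 4 * T.card - ‖S (a - b) x‖ ^ 2 / T.card) ≤ α / 2 * T.card :=
      (Finset.sum_le_sum fun a _ => Finset.sum_le_sum fun b _ => h5 a b).trans (h4 ▸ h3)
    have h9 : ∑ a, ∑ b, w a b * (3 / 4 * T.card - ‖S (a - b) x‖ ^ 2 / T.card) =
        β * (3 / 4 * T.card) - (∑ a, ∑ b, w a b * ‖S (a - b) x‖ ^ 2) / T.card := by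
      simp only [mul_sub, Finset.sum_sub_distrib, hβ, Finset.sum_mul, Finset.sum_div, mul_div_assoc]
    rw [h9] at h8
    have h10 : β * T.card / 4 ≤ (∑ a, ∑ b, w a b * ‖S (a - b) x‖ ^ 2) / T.card := by nlinarith
    rw [le_div_iff₀ hpos] at h10
    linarith
  have hup : ∑ x : Fin m → F, ∑ a, ∑ b, w a b * ‖S (a - b) x‖ ^ 2 =
      β * (T.card * Fintype.card (Fin m → F)) := by
    rw [Finset.sum_comm, hβ, Finset.sum_mul]
    refine Finset.sum_congr rfl fun a _ => ?_
    rw [Finset.sum_comm, Finset.sum_mul]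
    refine Finset.sum_congr rfl fun b _ => ?_
    rw [← Finset.mul_sum]
    by_cases hab : a = b
    · simp [hw, hab]
    · rw [sum_sq_norm_sum_character hψ T (sub_ne_zero.2 hab)]
  have h11 := Finset.sum_le_sum hlow
  rw [Finset.sum_const, nsmul_eq_mul] at h11
  have h12 := h11.trans (Finset.sum_le_sum_of_subset_of_nonneg (Finset.subset_univ _)
    fun x _ _ => Finset.sum_nonneg fun a _ => Finset.sum_nonneg fun b _ =>
      mul_nonneg (hw0 a b) (sq_nonneg _))
  rw [hup] at h12
  have hβpos : 0 < β * T.card := mul_pos (hα0.trans_le hβα) hpos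
  refine le_of_mul_le_mul_right ?_ hβpos
  nlinarith

lemma exists_subgroup_of_small_growth {G : Type*} [AddCommGroup G] [Fintype G] {B C : Finset G}
    (h0 : 0 ∈ B) (hneg : ∀ x ∈ B, -x ∈ B) (hadd : ∀ x ∈ B, ∀ y ∈ B, x + y ∈ C)
    (hcard : 2 * C.card < 3 * B.card) :
    ∃ H : AddSubgroup G, (∀ x ∈ B, x ∈ H) ∧ ∀ x ∈ H, x ∈ C := by
  have hlarge : ∀ a ∈ B, ∀ b ∈ B, B.card < 2 * (B.filter fun z => z - (a + b) ∈ B).card := by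
    intro a ha b hb
    have h1 : (B.image (fun z => z + a)).card = B.card :=
      Finset.card_image_of_injective _ (add_left_injective a)
    have h2 : (B.image (fun z => z + -b)).card = B.card :=
      Finset.card_image_of_injective _ (add_left_injective (-b))
    have h3 := Finset.card_union_add_card_inter (B.image (fun z => z + a))
      (B.image (fun z => z + -b))
    have h4 : (B.image (fun z => z + a) ∪ B.image (fun z => z + -b)).card ≤ C.card := by
      refine Finset.card_le_card (Finset.union_subset ?_ ?_) <;> rw [Finset.image_subset_iff]
      · exact fun z hz => hadd z hz a ha
      · exact fun z hz => hadd z hz _ (hneg b hb)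
    have h5 : (B.image (fun z => z + a) ∩ B.image (fun z => z + -b)).card ≤
        (B.filter fun z => z - (a + b) ∈ B).card := by
      refine Finset.card_le_card_of_injOn (fun z => z + b) (fun z hz => ?_)
        fun x _ y _ hxy => add_right_cancel hxy
      simp only [Finset.coe_inter, Finset.coe_image, Set.mem_inter_iff, Set.mem_image,
        Finset.mem_coe] at hz
      obtain ⟨⟨u, hu, rfl⟩, v, hv, hvu⟩ := hz
      have e1 : u + a + b = v := by rw [← hvu]; abel
      simp only [Finset.coe_filter, Set.mem_ofPred_eq, e1]
      refine ⟨hv, ?_⟩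
      rw [← e1]
      simpa [add_assoc] using hu
    omega
  let H : AddSubgroup G :=
    { carrier := {x | ∃ a ∈ B, ∃ b ∈ B, a + b = x}
      zero_mem' := ⟨0, h0, 0, h0, add_zero 0⟩
      neg_mem' := by
        rintro _ ⟨a, ha, b, hb, rfl⟩
        exact ⟨-a, hneg a ha, -b, hneg b hb, (neg_add a b).symm⟩
      add_mem' := by
        rintro _ _ ⟨a, ha, b, hb, rfl⟩ ⟨c, hc, d, hd, rfl⟩
        have h1 := hlarge a ha b hb
        have h2 := hlarge _ (hneg c hc) _ (hneg d hd)
        have h3 := Finset.card_union_add_card_inter (B.filter fun z => z - (a + b) ∈ B)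
          (B.filter fun z => z - (-c + -d) ∈ B)
        have h4 : ((B.filter fun z => z - (a + b) ∈ B) ∪
            (B.filter fun z => z - (-c + -d) ∈ B)).card ≤ B.card :=
          Finset.card_le_card (Finset.union_subset (Finset.filter_subset _ _)
            (Finset.filter_subset _ _))
        obtain ⟨z, hz⟩ := Finset.card_pos.1 (show 0 < ((B.filter fun z => z - (a + b) ∈ B) ∩
            (B.filter fun z => z - (-c + -d) ∈ B)).card by omega)
        simp only [Finset.mem_inter, Finset.mem_filter] at hz
        refine ⟨_, hz.2.2, _, hneg _ hz.1.2, ?_⟩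
        abel }
  refine ⟨H, fun x hx => ⟨x, hx, 0, h0, add_zero x⟩, ?_⟩
  rintro _ ⟨a, ha, b, hb, rfl⟩
  exact hadd a ha b hb

/-- Sublevel sets of an approximate quadratic form grow, or are trapped by a subgroup. -/
lemma growth_or_subgroup {G : Type*} [AddCommGroup G] [Fintype G] {D : G → ℝ} (h0 : D 0 = 0)
    (hneg : ∀ x, D (-x) = D x) (hadd : ∀ x y, D (x + y) ≤ 2 * (D x + D y)) {s : ℝ} (hs : 0 ≤ s) :
    25 * (Finset.univ.filter fun x => D x ≤ s).card ≤
        (Finset.univ.filter fun x => D x ≤ 4 ^ 8 * s).card ∨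
      ∃ H : AddSubgroup G, (∀ x, D x ≤ s → x ∈ H) ∧ ∀ x ∈ H, D x ≤ 4 ^ 8 * s := by
  set B : ℕ → Finset G := fun j => Finset.univ.filter fun x => D x ≤ 4 ^ j * s with hB
  have hmem : ∀ j x, x ∈ B j ↔ D x ≤ 4 ^ j * s := by simp [hB]
  have hB0 : (Finset.univ.filter fun x => D x ≤ s) = B 0 := by simp [hB]
  rw [hB0, show (Finset.univ.filter fun x => D x ≤ 4 ^ 8 * s) = B 8 from rfl]
  by_cases hg : ∀ j < 8, 3 * (B j).card ≤ 2 * (B (j + 1)).card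
  · left
    have a0 := hg 0 (by norm_num)
    have a1 := hg 1 (by norm_num)
    have a2 := hg 2 (by norm_num)
    have a3 := hg 3 (by norm_num)
    have a4 := hg 4 (by norm_num)
    have a5 := hg 5 (by norm_num)
    have a6 := hg 6 (by norm_num)
    have a7 := hg 7 (by norm_num)
    norm_num at *
    omega
  · right
    push Not at hg
    obtain ⟨j, hj, hlt⟩ := hg
    obtain ⟨H, hH1, hH2⟩ := exists_subgroup_of_small_growth (B := B j) (C := B (j + 1))
      ((hmem _ _).2 (by rw [h0]; positivity)) (fun x hx => by rw [hmem] at hx ⊢; rwa [hneg])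
      (fun x hx y hy => by
        rw [hmem] at hx hy ⊢
        have := hadd x y
        rw [pow_succ]; linarith) hlt
    refine ⟨H, fun x hx => hH1 x ((hmem _ _).2 (hx.trans ?_)),
      fun x hx => ((hmem _ _).1 (hH2 x hx)).trans ?_⟩
    · exact le_mul_of_one_le_left hs (one_le_pow₀ (by norm_num))
    · exact mul_le_mul_of_nonneg_right (pow_le_pow_right₀ (by norm_num) (by omega)) hs

/-- The exponential weight of `x` determined by the frequencies `ξ`. -/
def expWeight (ψ : AddChar F ℂ) (μ : F → ℝ) {k : ℕ} (ξ : Fin k → Fin m → F) (x : Fin m → F) : ℝ :=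
  Real.exp (-∑ l, defect ψ μ (ξ l ⬝ᵥ x))

lemma exists_frequencies {μ : Fin n → F → ℝ} (hμ : ∀ i, IsBalanced α (μ i))
    {T : Finset (Fin m → F)} (hT : T.Nonempty) (k : ℕ) :
    ∃ ξ : Fin k → Fin m → F, (∀ l, ξ l ∈ T) ∧ ∀ i, ∑ x, expWeight ψ (μ i) ξ x ≤
      (approxDual ψ α (μ i) T).card +
        n * Fintype.card (Fin m → F) * Real.exp (-(α / 4) * k) := by
  have hone : ∀ i, ∀ x, x ∉ approxDual ψ α (μ i) T →
      ∑ ξ ∈ T, Real.exp (-defect ψ (μ i) (ξ ⬝ᵥ x)) ≤ T.card * Real.exp (-(α / 4)) := by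
    intro i x hx
    simp only [approxDual, Finset.mem_filter, Finset.mem_univ, true_and, not_le] at hx
    have h1 : ∀ t : ℝ, 0 ≤ t → t ≤ 1 → Real.exp (-t) ≤ 1 - t / 2 := by
      intro t h0 h1
      have h3 : Real.exp (-t) * Real.exp t = 1 := by rw [← Real.exp_add]; simp
      have h4 : 1 + t + t ^ 2 / 2 ≤ Real.exp t := Real.quadratic_le_exp_of_nonneg h0
      have h5 := Real.exp_pos (-t)
      nlinarith [mul_nonneg h0 (sub_nonneg.2 h1), mul_nonneg (mul_nonneg h0 h0) (sub_nonneg.2 h1)]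
    calc ∑ ξ ∈ T, Real.exp (-defect ψ (μ i) (ξ ⬝ᵥ x))
        ≤ ∑ ξ ∈ T, (1 - defect ψ (μ i) (ξ ⬝ᵥ x) / 2) :=
          Finset.sum_le_sum fun ξ _ =>
            h1 _ (defect_nonneg (hμ i).1 (hμ i).2.1 _) (defect_le_one _)
      _ = T.card - (∑ ξ ∈ T, defect ψ (μ i) (ξ ⬝ᵥ x)) / 2 := by
          rw [Finset.sum_sub_distrib, Finset.sum_div]; simp
      _ ≤ T.card * (1 - α / 4) := by nlinarith
      _ ≤ T.card * Real.exp (-(α / 4)) :=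
          mul_le_mul_of_nonneg_left (Real.one_sub_le_exp_neg _) (Nat.cast_nonneg _)
  have havg : ∑ ξ ∈ Fintype.piFinset (fun _ : Fin k => T), ∑ i,
      ∑ x ∈ Finset.univ \ approxDual ψ α (μ i) T, expWeight ψ (μ i) ξ x ≤
      ∑ ξ ∈ Fintype.piFinset (fun _ : Fin k => T),
        (n * Fintype.card (Fin m → F) * Real.exp (-(α / 4) * k) : ℝ) := by
    rw [Finset.sum_comm, Finset.sum_const, Fintype.card_piFinset_const, nsmul_eq_mul]
    have h2 : ∀ i, ∑ ξ ∈ Fintype.piFinset (fun _ : Fin k => T),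
        ∑ x ∈ Finset.univ \ approxDual ψ α (μ i) T, expWeight ψ (μ i) ξ x ≤
        Fintype.card (Fin m → F) * (T.card * Real.exp (-(α / 4))) ^ k := by
      intro i
      rw [Finset.sum_comm]
      have h3 : ∀ x ∈ Finset.univ \ approxDual ψ α (μ i) T,
          ∑ ξ ∈ Fintype.piFinset (fun _ : Fin k => T), expWeight ψ (μ i) ξ x ≤
            (T.card * Real.exp (-(α / 4))) ^ k := by
        intro x hx
        have hx' := hone i x (Finset.mem_sdiff.1 hx).2
        refine le_trans (le_of_eq ?_) (pow_le_pow_left₀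
          (Finset.sum_nonneg fun ξ _ => (Real.exp_pos _).le) hx' k)
        rw [Finset.sum_pow']
        simp only [expWeight, ← Finset.sum_neg_distrib, Real.exp_sum]
      refine (Finset.sum_le_sum h3).trans ?_
      rw [Finset.sum_const, nsmul_eq_mul]
      refine mul_le_mul_of_nonneg_right ?_ (by positivity)
      exact_mod_cast (Finset.card_le_univ _)
    refine (Finset.sum_le_sum fun i _ => h2 i).trans (le_of_eq ?_)
    rw [Finset.sum_const, Finset.card_univ, Fintype.card_fin, nsmul_eq_mul, mul_pow,
      ← Real.exp_nat_mul]
    push_cast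
    rw [mul_comm (k : ℝ)]
    ring
  have hne : (Fintype.piFinset (fun _ : Fin k => T)).Nonempty :=
    Fintype.piFinset_nonempty.2 fun _ => hT
  obtain ⟨ξ, hξ, hle⟩ := Finset.exists_le_of_sum_le hne havg
  refine ⟨ξ, Fintype.mem_piFinset.1 hξ, fun i => ?_⟩
  rw [← Finset.sum_sdiff (Finset.subset_univ (approxDual ψ α (μ i) T)), add_comm]
  refine add_le_add ?_ (le_trans ?_ hle)
  · refine (Finset.sum_le_sum (g := fun _ => (1 : ℝ)) fun x _ => ?_).trans (by simp)
    exact Real.exp_le_one_iff.2 (neg_nonpos.2 (Finset.sum_nonneg fun l _ =>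
      defect_nonneg (hμ i).1 (hμ i).2.1 _))
  · exact Finset.single_le_sum (f := fun i => ∑ x ∈ Finset.univ \ approxDual ψ α (μ i) T,
      expWeight ψ (μ i) ξ x)
      (fun i _ => Finset.sum_nonneg fun x _ => (Real.exp_pos _).le) (Finset.mem_univ i)

/-- The sum over all frequencies of the absolute value of the Fourier transform of the random
vector `∑ i, x i • V i` with independent coefficients `x i` of law `μ i`. -/
def spectralSum (ψ : AddChar F ℂ) (μ : Fin n → F → ℝ) (V : Fin n → Fin m → F) : ℝ :=
  ∑ ξ : Fin m → F, ∏ i, ‖fourier ψ (μ i) (ξ ⬝ᵥ V i)‖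

lemma prod_norm_fourier_le_one {μ : Fin n → F → ℝ} (hμ : ∀ i, IsBalanced α (μ i))
    (V : Fin n → Fin m → F) (ξ : Fin m → F) : ∏ i, ‖fourier ψ (μ i) (ξ ⬝ᵥ V i)‖ ≤ 1 :=
  Finset.prod_le_one (fun _ _ => norm_nonneg _)
    fun i _ => norm_fourier_le_one (hμ i).1 (hμ i).2.1 _

lemma prod_norm_fourier_zero {μ : Fin n → F → ℝ} (hμ : ∀ i, IsBalanced α (μ i))
    (V : Fin n → Fin m → F) : ∏ i, ‖fourier ψ (μ i) ((0 : Fin m → F) ⬝ᵥ V i)‖ = 1 := by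
  refine Finset.prod_eq_one fun i _ => ?_
  rw [zero_dotProduct, fourier]
  simp only [mul_zero, AddChar.map_zero_eq_one, mul_one]
  rw [← Complex.ofReal_sum, (hμ i).2.1]
  simp

lemma one_le_spectralSum {μ : Fin n → F → ℝ} (hμ : ∀ i, IsBalanced α (μ i))
    (V : Fin n → Fin m → F) : 1 ≤ spectralSum ψ μ V := by
  rw [← prod_norm_fourier_zero (ψ := ψ) hμ V]
  exact Finset.single_le_sum (f := fun ξ : Fin m → F => ∏ i, ‖fourier ψ (μ i) (ξ ⬝ᵥ V i)‖)
    (fun ξ _ => Finset.prod_nonneg fun i _ => norm_nonneg _) (Finset.mem_univ 0)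

lemma spectralSum_le_card {μ : Fin n → F → ℝ} (hμ : ∀ i, IsBalanced α (μ i))
    (V : Fin n → Fin m → F) : spectralSum ψ μ V ≤ Fintype.card (Fin m → F) := by
  refine (Finset.sum_le_sum fun ξ _ => prod_norm_fourier_le_one hμ V ξ).trans ?_
  simp

/-- The contribution of all tuples of `k` frequencies to the bound for structured arrays `V`. -/
def structuredBound (ψ : AddChar F ℂ) (μ : Fin n → F → ℝ) (κ s : ℝ) (k : ℕ)
    (V : Fin n → Fin m → F) : ℝ :=
  ∑ ξ : Fin k → Fin m → F, (1 - κ) ^ n * Real.exp (k * s) *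
    ∏ i, (expWeight ψ (μ i) ξ (V i) / ∑ x, expWeight ψ (μ i) ξ x)

lemma sum_expWeight_pos (μ : F → ℝ) {k : ℕ} (ξ : Fin k → Fin m → F) :
    0 < ∑ x, expWeight ψ μ ξ x :=
  Finset.sum_pos (fun _ _ => Real.exp_pos _) Finset.univ_nonempty

lemma structuredBound_nonneg (μ : Fin n → F → ℝ) {κ : ℝ} (hκ : κ ≤ 1) (s : ℝ) (k : ℕ)
    (V : Fin n → Fin m → F) : 0 ≤ structuredBound ψ μ κ s k V :=
  Finset.sum_nonneg fun ξ _ => mul_nonneg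
    (mul_nonneg (pow_nonneg (by linarith) _) (Real.exp_pos _).le)
    (Finset.prod_nonneg fun i _ => div_nonneg (Real.exp_pos _).le (sum_expWeight_pos _ ξ).le)

lemma sum_structuredBound (μ : Fin n → F → ℝ) (κ s : ℝ) (k : ℕ) :
    ∑ V : Fin n → Fin m → F, structuredBound ψ μ κ s k V =
      (Fintype.card (Fin m → F) : ℝ) ^ k * ((1 - κ) ^ n * Real.exp (k * s)) := by
  simp only [structuredBound]
  rw [Finset.sum_comm]
  have h : ∀ ξ : Fin k → Fin m → F, ∑ V : Fin n → Fin m → F, (1 - κ) ^ n * Real.exp (k * s) *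
      ∏ i, (expWeight ψ (μ i) ξ (V i) / ∑ x, expWeight ψ (μ i) ξ x) =
      (1 - κ) ^ n * Real.exp (k * s) := by
    intro ξ
    rw [← Finset.mul_sum]
    have h2 := Finset.prod_univ_sum (fun _ : Fin n => (Finset.univ : Finset (Fin m → F)))
      (fun i y => expWeight ψ (μ i) ξ y / ∑ x, expWeight ψ (μ i) ξ x)
    rw [Fintype.piFinset_univ] at h2
    rw [← h2, Finset.prod_eq_one fun i _ => ?_, mul_one]
    rw [← Finset.sum_div, div_self (sum_expWeight_pos _ ξ).ne']
  rw [Finset.sum_congr rfl fun ξ _ => h ξ, Finset.sum_const, nsmul_eq_mul, Finset.card_univ,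
    Fintype.card_fun, Fintype.card_fin]
  push_cast
  rfl

lemma pow_le_structuredBound {μ : Fin n → F → ℝ} (hμ : ∀ i, IsBalanced α (μ i))
    {V : Fin n → Fin m → F} {A s κ η : ℝ} {T : Finset (Fin m → F)} (hT : T.Nonempty) {k : ℕ}
    (hTs : ∀ ξ ∈ T, ∑ i, defect ψ (μ i) (ξ ⬝ᵥ V i) ≤ s) (hκ : κ ≤ 1)
    (hη : n * Fintype.card (Fin m → F) * Real.exp (-(α / 4) * k) ≤ η) (hA0 : 0 ≤ A)
    (hA : ∀ i, A * ((approxDual ψ α (μ i) T).card + η) ≤ (1 - κ) * Fintype.card (Fin m → F)) :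
    (A / Fintype.card (Fin m → F)) ^ n ≤ structuredBound ψ μ κ s k V := by
  have hN : (0 : ℝ) < Fintype.card (Fin m → F) := by exact_mod_cast Fintype.card_pos
  obtain ⟨ξ, hξT, hξ⟩ := exists_frequencies (ψ := ψ) hμ hT k
  have h1 : (A / Fintype.card (Fin m → F)) ^ n ≤
      ∏ i, ((1 - κ) / ∑ x, expWeight ψ (μ i) ξ x) := by
    have : (A / Fintype.card (Fin m → F)) ^ n = ∏ _i : Fin n, A / Fintype.card (Fin m → F) := by
      rw [Finset.prod_const, Finset.card_univ, Fintype.card_fin]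
    rw [this]
    refine Finset.prod_le_prod (fun _ _ => by positivity) fun i _ => ?_
    rw [div_le_div_iff₀ hN (sum_expWeight_pos _ ξ)]
    exact (mul_le_mul_of_nonneg_left ((hξ i).trans (by linarith)) hA0).trans (hA i)
  have h2 : 1 ≤ Real.exp (k * s) * ∏ i, expWeight ψ (μ i) ξ (V i) := by
    simp only [expWeight]
    rw [← Real.exp_sum, ← Real.exp_add, Real.one_le_exp_iff, Finset.sum_neg_distrib,
      Finset.sum_comm]
    have : ∑ l, ∑ i, defect ψ (μ i) (ξ l ⬝ᵥ V i) ≤ ∑ _l : Fin k, s :=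
      Finset.sum_le_sum fun l _ => hTs _ (hξT l)
    simp only [Finset.sum_const, Finset.card_univ, Fintype.card_fin, nsmul_eq_mul] at this
    linarith
  have h3 : ∏ i, ((1 - κ) / ∑ x, expWeight ψ (μ i) ξ x) ≤ (1 - κ) ^ n * Real.exp (k * s) *
      ∏ i, (expWeight ψ (μ i) ξ (V i) / ∑ x, expWeight ψ (μ i) ξ x) := by
    have hP : 0 ≤ ∏ i, ((1 - κ) / ∑ x, expWeight ψ (μ i) ξ x) :=
      Finset.prod_nonneg fun i _ => div_nonneg (by linarith) (sum_expWeight_pos _ ξ).le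
    refine (le_mul_of_one_le_left hP h2).trans (le_of_eq ?_)
    simp only [Finset.prod_div_distrib, Finset.prod_const, Finset.card_univ, Fintype.card_fin]
    ring
  refine (h1.trans h3).trans ?_
  exact Finset.single_le_sum (f := fun ξ : Fin k → Fin m → F => (1 - κ) ^ n * Real.exp (k * s) *
    ∏ i, (expWeight ψ (μ i) ξ (V i) / ∑ x, expWeight ψ (μ i) ξ x))
    (fun ξ _ => mul_nonneg (mul_nonneg (pow_nonneg (by linarith) _) (Real.exp_pos _).le)
      (Finset.prod_nonneg fun i _ => div_nonneg (Real.exp_pos _).le (sum_expWeight_pos _ ξ).le))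
    (Finset.mem_univ ξ)

lemma spectralSum_le_add {μ : Fin n → F → ℝ} (V : Fin n → Fin m → F) {T : Finset (Fin m → F)}
    (hT : ∀ ξ, ∑ i, defect ψ (μ i) (ξ ⬝ᵥ V i) ≤ 4 * Real.log (Fintype.card (Fin m → F)) → ξ ∈ T) :
    spectralSum ψ μ V ≤ ∑ ξ ∈ T, ∏ i, ‖fourier ψ (μ i) (ξ ⬝ᵥ V i)‖ +
      (Fintype.card (Fin m → F) : ℝ)⁻¹ := by
  have hN : (0 : ℝ) < Fintype.card (Fin m → F) := by exact_mod_cast Fintype.card_pos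
  set N : ℝ := (Fintype.card (Fin m → F) : ℝ) with hNdef
  rw [spectralSum, ← Finset.sum_sdiff (Finset.subset_univ T), add_comm]
  refine add_le_add le_rfl ?_
  have h : ∀ ξ ∈ Finset.univ \ T, ∏ i, ‖fourier ψ (μ i) (ξ ⬝ᵥ V i)‖ ≤ (N ^ 2)⁻¹ := by
    intro ξ hξ
    have h1 : 4 * Real.log N < ∑ i, defect ψ (μ i) (ξ ⬝ᵥ V i) := by
      by_contra! hle
      exact (Finset.mem_sdiff.1 hξ).2 (hT ξ hle)
    refine (Finset.prod_le_prod (fun _ _ => norm_nonneg _)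
      fun i _ => norm_fourier_le_exp _).trans ?_
    rw [← Real.exp_sum, ← Real.exp_log (inv_pos.2 (pow_pos hN 2)), Real.exp_le_exp, Real.log_inv,
      Real.log_pow, ← Finset.sum_div, Finset.sum_neg_distrib]
    push_cast
    linarith
  refine (Finset.sum_le_sum h).trans ?_
  rw [Finset.sum_const, nsmul_eq_mul]
  calc ((Finset.univ \ T).card : ℝ) * (N ^ 2)⁻¹ ≤ N * (N ^ 2)⁻¹ := by
        refine mul_le_mul_of_nonneg_right ?_ (by positivity)
        rw [hNdef]
        exact_mod_cast Finset.card_le_univ _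
    _ = N⁻¹ := by field_simp

lemma pow_spectralSum_le (hα0 : 0 < α) (hα1 : α < 1) (hψ : ψ.IsPrimitive) {μ : Fin n → F → ℝ}
    (hμ : ∀ i, IsBalanced α (μ i)) (hcard : 16 / α ≤ Fintype.card (Fin m → F)) {k : ℕ}
    (hk : n * Fintype.card (Fin m → F) * Real.exp (-(α / 4) * k) ≤ α / 8)
    {V : Fin n → Fin m → F} (hV : ∀ ξ, ξ ≠ 0 → ∃ i, ξ ⬝ᵥ V i ≠ 0) :
    (spectralSum ψ μ V / Fintype.card (Fin m → F)) ^ n ≤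
      (1 + n * Real.exp (n * (α / 16)) * (spectralSum ψ μ V - 1)) /
          (Fintype.card (Fin m → F) : ℝ) ^ n +
        structuredBound ψ μ (α / 8) (4 ^ 8 * (4 * Real.log (Fintype.card (Fin m → F)))) k V := by
  have hA1 := one_le_spectralSum (ψ := ψ) hμ V
  have hAN := spectralSum_le_card (ψ := ψ) hμ V
  have htail := fun T => spectralSum_le_add (ψ := ψ) (μ := μ) V (T := T)
  set N : ℝ := (Fintype.card (Fin m → F) : ℝ) with hNdef
  set A := spectralSum ψ μ V with hAdef
  have hN16 : 16 ≤ N := le_trans (by rw [le_div_iff₀ hα0]; linarith) hcard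
  have hN : 0 < N := by linarith
  have hNinv : N⁻¹ ≤ α / 16 := by
    rw [inv_le_comm₀ hN (by positivity), inv_div]; exact hcard
  have hlog : 0 ≤ 4 * Real.log N := mul_nonneg (by norm_num) (Real.log_nonneg (by linarith))
  have hmain0 : 0 ≤ (1 + n * Real.exp (n * (α / 16)) * (A - 1)) / N ^ n := by
    have : 0 ≤ A - 1 := by linarith
    positivity
  have hstr0 := structuredBound_nonneg (ψ := ψ) μ (κ := α / 8) (by linarith)
    (4 ^ 8 * (4 * Real.log N)) k V
  have hAη : A * (α / 8) ≤ N * (α / 8) := mul_le_mul_of_nonneg_right hAN (by linarith)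
  have hstruct : ∀ T : Finset (Fin m → F), T.Nonempty →
      (∀ ξ ∈ T, ∑ i, defect ψ (μ i) (ξ ⬝ᵥ V i) ≤ 4 ^ 8 * (4 * Real.log N)) →
      (∀ i, A * (approxDual ψ α (μ i) T).card ≤ (1 - α / 4) * N) →
      (A / N) ^ n ≤ (1 + n * Real.exp (n * (α / 16)) * (A - 1)) / N ^ n +
        structuredBound ψ μ (α / 8) (4 ^ 8 * (4 * Real.log N)) k V := by
    intro T hT hTs hTA
    refine (pow_le_structuredBound hμ hT hTs (by linarith) hk (by linarith) fun i => ?_).trans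
      (le_add_of_nonneg_left hmain0)
    have := hTA i
    rw [← hNdef]
    linarith
  rcases growth_or_subgroup (D := fun ξ => ∑ i, defect ψ (μ i) (ξ ⬝ᵥ V i))
    (by simp [defect_zero (hμ _).2.1])
    (fun ξ => by simp only [neg_dotProduct, defect_neg (hμ _).2.1])
    (fun ξ η => by
      simp only [add_dotProduct, ← Finset.sum_add_distrib, Finset.mul_sum]
      exact Finset.sum_le_sum fun i _ => defect_add_le (hμ i).1 (hμ i).2.1 _ _) hlog with hg | hH
  · have hmem : ∀ ξ ∈ (Finset.univ.filter fun ξ : Fin m → F =>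
        ∑ i, defect ψ (μ i) (ξ ⬝ᵥ V i) ≤ 4 ^ 8 * (4 * Real.log N)),
        ∑ i, defect ψ (μ i) (ξ ⬝ᵥ V i) ≤ 4 ^ 8 * (4 * Real.log N) := fun ξ hξ =>
      (Finset.mem_filter.1 hξ).2
    have hAB := htail (Finset.univ.filter fun ξ : Fin m → F =>
        ∑ i, defect ψ (μ i) (ξ ⬝ᵥ V i) ≤ 4 * Real.log N) (by simp [hNdef])
    set B := (Finset.univ.filter fun ξ : Fin m → F =>
        ∑ i, defect ψ (μ i) (ξ ⬝ᵥ V i) ≤ 4 * Real.log N)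
    set T := (Finset.univ.filter fun ξ : Fin m → F =>
        ∑ i, defect ψ (μ i) (ξ ⬝ᵥ V i) ≤ 4 ^ 8 * (4 * Real.log N))
    have hB0 : (0 : Fin m → F) ∈ B := by
      simp [B, defect_zero (hμ _).2.1, Real.log_nonneg (show 1 ≤ N by linarith)]
    have hB1 : (1 : ℝ) ≤ B.card := by exact_mod_cast Finset.card_pos.2 ⟨0, hB0⟩
    have hgR : 25 * (B.card : ℝ) ≤ T.card := by exact_mod_cast hg
    have hAB2 : A ≤ B.card + N⁻¹ := by
      refine hAB.trans (add_le_add ?_ le_rfl)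
      refine (Finset.sum_le_sum fun ξ _ => prod_norm_fourier_le_one hμ V ξ).trans ?_
      simp
    have hTpos : (0 : ℝ) < T.card := by linarith
    refine hstruct T (Finset.card_pos.1 (by exact_mod_cast hTpos)) hmem fun i => ?_
    have h4 := card_approxDual_le hα0 hψ (hμ i) (Finset.card_pos.1 (by exact_mod_cast hTpos))
    have h5 : 20 * A ≤ T.card := by linarith
    have h6 : (0 : ℝ) ≤ (approxDual ψ α (μ i) T).card := Nat.cast_nonneg _
    nlinarith
  · obtain ⟨H, hH1, hH2⟩ := hH
    set T := Finset.univ.filter fun ξ => ξ ∈ H with hTdef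
    have hT : ∀ ξ, ξ ∈ T ↔ ξ ∈ H := by simp [hTdef]
    have hAT := htail T (fun ξ hξ => (hT ξ).2 (hH1 ξ hξ))
    by_cases hbot : H = ⊥
    · refine le_trans ?_ (le_add_of_nonneg_right hstr0)
      have hT0 : T = {0} := by
        ext ξ; simp [hT, hbot]
      rw [hT0, Finset.sum_singleton, prod_norm_fourier_zero hμ] at hAT
      rw [div_pow]
      refine div_le_div_of_nonneg_right ?_ (by positivity)
      set y := A - 1 with hy
      have hy0 : 0 ≤ y := by linarith
      have hy1 : y ≤ α / 16 := by linarith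
      have h1 : A ^ n ≤ Real.exp (n * y) := by
        rw [Real.exp_nat_mul]
        refine pow_le_pow_left₀ (by linarith) ?_ n
        have := Real.add_one_le_exp y
        linarith
      have h2 : Real.exp (n * y) ≤ 1 + n * y * Real.exp (n * y) := by
        have h3 := Real.one_sub_le_exp_neg (n * y)
        have h4 : Real.exp (-(n * y)) * Real.exp (n * y) = 1 := by rw [← Real.exp_add]; simp
        nlinarith [Real.exp_pos (n * y)]
      have h3 : Real.exp (n * y) ≤ Real.exp (n * (α / 16)) :=
        Real.exp_le_exp.2 (mul_le_mul_of_nonneg_left hy1 (Nat.cast_nonneg _))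
      have h4 : n * y * Real.exp (n * y) ≤ n * y * Real.exp (n * (α / 16)) :=
        mul_le_mul_of_nonneg_left h3 (by positivity)
      linarith
    · obtain ⟨⟨h, hh⟩, hne'⟩ := AddSubgroup.ne_bot_iff_exists_ne_zero.1 hbot
      have hne : h ≠ 0 := fun e => hne' (Subtype.ext e)
      obtain ⟨i₀, hi₀⟩ := hV _ hne
      have hT1 : (1 : ℝ) ≤ T.card := by
        exact_mod_cast Finset.card_pos.2 ⟨0, (hT 0).2 H.zero_mem⟩
      have h5 : ∑ ξ ∈ T, ∏ i, ‖fourier ψ (μ i) (ξ ⬝ᵥ V i)‖ ≤ (1 - α / 2) * T.card := by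
        refine le_trans (Finset.sum_le_sum fun ξ _ => ?_)
          (sum_norm_fourier_le hα1 hψ (hμ i₀) H hT ⟨_, hh, hi₀⟩)
        rw [← Finset.mul_prod_erase _ _ (Finset.mem_univ i₀)]
        exact mul_le_of_le_one_right (norm_nonneg _) (Finset.prod_le_one
          (fun _ _ => norm_nonneg _) fun i _ => norm_fourier_le_one (hμ i).1 (hμ i).2.1 _)
      refine hstruct T ⟨0, (hT 0).2 H.zero_mem⟩ (fun ξ hξ => hH2 ξ ((hT ξ).1 hξ)) fun i => ?_
      have h6 := card_approxDual_subgroup hα0 hψ (hμ i) H hT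
      have h7 : (0 : ℝ) ≤ (approxDual ψ α (μ i) T).card := Nat.cast_nonneg _
      have h8 : A ≤ (1 - α / 4) * T.card := by nlinarith
      calc A * (approxDual ψ α (μ i) T).card
          ≤ (1 - α / 4) * T.card * (approxDual ψ α (μ i) T).card :=
            mul_le_mul_of_nonneg_right h8 h7
        _ = (1 - α / 4) * ((approxDual ψ α (μ i) T).card * T.card) := by ring
        _ ≤ (1 - α / 4) * N := mul_le_mul_of_nonneg_left h6 (by linarith)

lemma sum_spectralSum_sub_one_le (hα1 : α < 1) (hψ : ψ.IsPrimitive)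
    {μ : Fin n → F → ℝ} (hμ : ∀ i, IsBalanced α (μ i)) :
    ∑ V : Fin n → Fin m → F, (spectralSum ψ μ V - 1) ≤
      Fintype.card (Fin m → F) * ((1 - α / 2) * Fintype.card (Fin m → F)) ^ n := by
  have h1 : ∀ V : Fin n → Fin m → F, spectralSum ψ μ V - 1 =
      ∑ ξ ∈ Finset.univ.erase (0 : Fin m → F), ∏ i, ‖fourier ψ (μ i) (ξ ⬝ᵥ V i)‖ := by
    intro V
    rw [spectralSum, ← Finset.add_sum_erase _ _ (Finset.mem_univ 0), prod_norm_fourier_zero hμ]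
    ring
  rw [Finset.sum_congr rfl fun V _ => h1 V, Finset.sum_comm]
  have h2 : ∀ ξ ∈ Finset.univ.erase (0 : Fin m → F), ∑ V : Fin n → Fin m → F,
      ∏ i, ‖fourier ψ (μ i) (ξ ⬝ᵥ V i)‖ ≤ ((1 - α / 2) * Fintype.card (Fin m → F)) ^ n := by
    intro ξ hξ
    have h3 := Finset.prod_univ_sum (fun _ : Fin n => (Finset.univ : Finset (Fin m → F)))
      (fun i y => ‖fourier ψ (μ i) (ξ ⬝ᵥ y)‖)
    rw [Fintype.piFinset_univ] at h3
    rw [← h3]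
    refine (Finset.prod_le_prod (g := fun _ => (1 - α / 2) * Fintype.card (Fin m → F))
      (fun i _ => Finset.sum_nonneg fun _ _ => norm_nonneg _) fun i _ => ?_).trans
      (by rw [Finset.prod_const, Finset.card_univ, Fintype.card_fin])
    obtain ⟨j, hj⟩ := Function.ne_iff.1 (Finset.ne_of_mem_erase hξ)
    have h4 := sum_norm_fourier_le hα1 hψ (hμ i) (⊤ : AddSubgroup (Fin m → F))
      (T := Finset.univ) (by simp) (x := ξ) ⟨Pi.single j 1, by simp, by simpa using hj⟩
    simpa only [dotProduct_comm ξ, Finset.card_univ] using h4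
  refine (Finset.sum_le_sum h2).trans ?_
  rw [Finset.sum_const, nsmul_eq_mul]
  refine mul_le_mul_of_nonneg_right ?_ (pow_nonneg (mul_nonneg (by linarith) (by positivity)) _)
  exact_mod_cast Finset.card_le_univ _

/-- Moment bound for the spectral sums of the nondegenerate arrays. -/
lemma sum_pow_spectralSum_le (hα0 : 0 < α) (hα1 : α < 1) (hψ : ψ.IsPrimitive)
    {μ : Fin n → F → ℝ} (hμ : ∀ i, IsBalanced α (μ i))
    (hcard : 16 / α ≤ Fintype.card (Fin m → F)) {k : ℕ}
    (hk : n * Fintype.card (Fin m → F) * Real.exp (-(α / 4) * k) ≤ α / 8) :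
    ∑ V ∈ Finset.univ.filter (fun V : Fin n → Fin m → F => ∀ ξ, ξ ≠ 0 → ∃ i, ξ ⬝ᵥ V i ≠ 0),
        (spectralSum ψ μ V / Fintype.card (Fin m → F)) ^ n ≤
      1 + n * Real.exp (n * (α / 16)) * (Fintype.card (Fin m → F) * (1 - α / 2) ^ n) +
        (Fintype.card (Fin m → F) : ℝ) ^ k * ((1 - α / 8) ^ n *
          Real.exp (k * (4 ^ 8 * (4 * Real.log (Fintype.card (Fin m → F)))))) := by
  have hsum := sum_spectralSum_sub_one_le (m := m) hα1 hψ hμ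
  have hN : (0 : ℝ) < Fintype.card (Fin m → F) := by exact_mod_cast Fintype.card_pos
  have hcV : (Fintype.card (Fin n → Fin m → F) : ℝ) = (Fintype.card (Fin m → F) : ℝ) ^ n := by
    rw [Fintype.card_fun, Fintype.card_fin]; push_cast; rfl
  have h1 := Finset.sum_le_sum fun V
      (hV : V ∈ Finset.univ.filter (fun V : Fin n → Fin m → F => ∀ ξ, ξ ≠ 0 → ∃ i, ξ ⬝ᵥ V i ≠ 0)) =>
    pow_spectralSum_le hα0 hα1 hψ hμ hcard hk (Finset.mem_filter.1 hV).2
  refine h1.trans ((Finset.sum_le_sum_of_subset_of_nonneg (Finset.subset_univ _)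
    fun V _ _ => ?_).trans ?_)
  · have := one_le_spectralSum (ψ := ψ) hμ V
    have h0 : 0 ≤ spectralSum ψ μ V - 1 := by linarith
    have := structuredBound_nonneg (ψ := ψ) μ (κ := α / 8) (by linarith)
      (4 ^ 8 * (4 * Real.log (Fintype.card (Fin m → F)))) k V
    positivity
  · rw [Finset.sum_add_distrib, sum_structuredBound, ← Finset.sum_div, Finset.sum_add_distrib,
      ← Finset.mul_sum]
    refine add_le_add ?_ le_rfl
    rw [Finset.sum_const, Finset.card_univ, nsmul_eq_mul, mul_one, hcV, add_div, div_self
      (by positivity), mul_div_assoc]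
    refine add_le_add le_rfl (mul_le_mul_of_nonneg_left ?_ (by positivity))
    rw [div_le_iff₀ (by positivity)]
    refine hsum.trans (le_of_eq ?_)
    rw [mul_pow]; ring

lemma map_sum_eq_prod {ι R : Type*} [AddCommMonoid R] (χ : AddChar R ℂ) (s : Finset ι) (f : ι → R) :
    χ (∑ i ∈ s, f i) = ∏ i ∈ s, χ (f i) :=
  map_prod χ.toMonoidHom (fun i => Multiplicative.ofAdd (f i)) s

/-- A linear image of a random vector with independent coordinates has all its point masses bounded
by its normalised spectral sum. -/
lemma sum_filter_prod_le_spectralSum (hψ : ψ.IsPrimitive) (μ : Fin n → F → ℝ)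
    (hμ : ∀ i a, 0 ≤ μ i a) (V : Fin n → Fin m → F) (w : Fin m → F) :
    ∑ x ∈ Finset.univ.filter (fun x : Fin n → F => ∑ i, x i • V i = w), ∏ i, μ i (x i) ≤
      spectralSum ψ μ V / Fintype.card (Fin m → F) := by
  have hN : (0 : ℝ) < Fintype.card (Fin m → F) := by exact_mod_cast Fintype.card_pos
  rw [le_div_iff₀ hN]
  set L : ℝ := ∑ x ∈ Finset.univ.filter (fun x : Fin n → F => ∑ i, x i • V i = w), ∏ i, μ i (x i)
    with hL
  have hL0 : 0 ≤ L := Finset.sum_nonneg fun x _ => Finset.prod_nonneg fun i _ => hμ i _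
  have key : ((L * Fintype.card (Fin m → F) : ℝ) : ℂ) =
      ∑ ξ : Fin m → F, ψ (-(ξ ⬝ᵥ w)) * ∏ i, fourier ψ (μ i) (ξ ⬝ᵥ V i) := by
    have h1 : ((L * Fintype.card (Fin m → F) : ℝ) : ℂ) = ∑ x : Fin n → F,
        (∏ i, (μ i (x i) : ℂ)) * ∑ ξ : Fin m → F, ψ (ξ ⬝ᵥ (∑ i, x i • V i - w)) := by
      rw [hL, Finset.sum_filter, Finset.sum_mul]
      push_cast
      refine Finset.sum_congr rfl fun x _ => ?_
      rw [sum_dotProduct hψ]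
      by_cases h : ∑ i, x i • V i = w
      · simp [h]
      · simp [h, sub_eq_zero]
    rw [h1]
    simp only [Finset.mul_sum]
    rw [Finset.sum_comm]
    refine Finset.sum_congr rfl fun ξ _ => ?_
    simp only [fourier]
    rw [Finset.prod_univ_sum, Fintype.piFinset_univ, Finset.mul_sum]
    refine Finset.sum_congr rfl fun x _ => ?_
    rw [Finset.prod_mul_distrib, dotProduct_sub, sub_eq_add_neg, AddChar.map_add_eq_mul,
      dotProduct_sum, map_sum_eq_prod]
    simp only [dotProduct_smul, smul_eq_mul]
    ring
  have h2 : L * Fintype.card (Fin m → F) = ‖((L * Fintype.card (Fin m → F) : ℝ) : ℂ)‖ := by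
    rw [Complex.norm_real, Real.norm_of_nonneg (by positivity)]
  rw [h2, key]
  refine (norm_sum_le _ _).trans (Finset.sum_le_sum fun ξ _ => ?_)
  rw [norm_mul, AddChar.norm_apply, one_mul, norm_prod]

/-- Events that constrain the columns separately have product probability. -/
lemma matProb_forall_column {K : Type*} [Fintype K] (μ : Fin n → Fin n → K → ℝ)
    (P : Fin n → (Fin n → K) → Prop)
    [∀ c, DecidablePred (P c)] :
    matProb μ {M | ∀ c, P c fun i => M i c} =
      ∏ c, ∑ x ∈ Finset.univ.filter (P c), ∏ i, μ i c (x i) := by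
  rw [Finset.prod_univ_sum, matProb]
  refine Finset.sum_nbij' (fun M c i => M i c) (fun x => Matrix.of fun i c => x c i) ?_ ?_ ?_ ?_ ?_
  · intro M hM
    simpa using hM
  · intro x hx
    simp only [Finset.mem_filter, Finset.mem_univ, true_and]
    exact fun c => by simpa using Fintype.mem_piFinset.1 hx c
  · intro M _; rfl
  · intro x _; rfl
  · intro M _
    exact Finset.prod_comm

/-- Given left eigenvectors for distinct eigenvalues, no nontrivial linear form annihilates all the
coordinates of these eigenvectors. -/
lemma exists_dotProduct_ne_zero {K : Type*} [Field K] {M : Matrix (Fin n) (Fin n) K}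
    {lam : Fin m → K}
    (hlam : Function.Injective lam) {v : Fin m → Fin n → K} (hv0 : ∀ j, v j ≠ 0)
    (hv : ∀ j, Matrix.vecMul (v j) M = lam j • v j) {ξ : Fin m → K} (hξ : ξ ≠ 0) :
    ∃ i, ξ ⬝ᵥ (fun j => v j i) ≠ 0 := by
  have hli : LinearIndependent K v :=
    Module.End.eigenvectors_linearIndependent' (Matrix.vecMulLinear M) lam hlam v fun j =>
      Module.End.hasEigenvector_iff.2 ⟨Module.End.mem_eigenspace_iff.2 (hv j), hv0 j⟩
  by_contra! h
  refine hξ (funext (Fintype.linearIndependent_iff.1 hli ξ ?_))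
  ext i
  simpa [dotProduct] using h i

/-- A matrix having all `lam j` as eigenvalues admits at least `(q - 1) ^ m` choices of a system of
left eigenvectors. -/
lemma pow_le_card_eigenvectors {M : Matrix (Fin n) (Fin n) F} {lam : Fin m → F}
    (hlam : Function.Injective lam)
    (hM : ∀ j, (M - lam j • (1 : Matrix (Fin n) (Fin n) F)).det = 0) :
    (Fintype.card F - 1) ^ m ≤ (Finset.univ.filter fun V : Fin n → Fin m → F =>
      (∀ ξ, ξ ≠ 0 → ∃ i, ξ ⬝ᵥ V i ≠ 0) ∧
        ∀ c, ∑ i, M i c • V i = fun j => lam j * V c j).card := by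
  have h : ∀ j, ∃ v : Fin n → F, v ≠ 0 ∧ Matrix.vecMul v M = lam j • v := by
    intro j
    obtain ⟨v, hv0, hv⟩ := Matrix.exists_vecMul_eq_zero_iff.2 (hM j)
    refine ⟨v, hv0, ?_⟩
    rw [Matrix.vecMul_sub, sub_eq_zero] at hv
    rw [hv, Matrix.vecMul_smul, Matrix.vecMul_one]
  choose v hv0 hv using h
  have hcard : (Fintype.card F - 1) ^ m = (Finset.univ : Finset (Fin m → Fˣ)).card := by
    rw [Finset.card_univ, Fintype.card_fun, Fintype.card_fin, Fintype.card_units]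
  rw [hcard]
  refine Finset.card_le_card_of_injOn (fun u i j => (u j : F) * v j i) (fun u _ => ?_) ?_
  · have hv' : ∀ j, Matrix.vecMul ((u j : F) • v j) M = lam j • ((u j : F) • v j) := fun j => by
      rw [Matrix.smul_vecMul, hv, smul_comm]
    refine Finset.mem_filter.2 ⟨Finset.mem_univ _, fun ξ hξ => ?_, fun c => ?_⟩
    · exact exists_dotProduct_ne_zero hlam (v := fun j => (u j : F) • v j)
        (fun j => smul_ne_zero (u j).ne_zero (hv0 j)) hv' hξ
    · ext j
      have := congrFun (hv' j) c
      simp only [Matrix.vecMul, dotProduct, Pi.smul_apply, smul_eq_mul] at this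
      rw [Finset.sum_apply, ← this]
      exact Finset.sum_congr rfl fun i _ => by simp only [Pi.smul_apply, smul_eq_mul]; ring
  · intro u _ u' _ huu
    ext j
    obtain ⟨i, hi⟩ := Function.ne_iff.1 (hv0 j)
    exact mul_right_cancel₀ hi (congrFun (congrFun huu i) j)

lemma matProb_eigenvalues_le {μ : Fin n → Fin n → F → ℝ} (hμ : ∀ i j a, 0 ≤ μ i j a)
    {lam : Fin m → F} (hlam : Function.Injective lam) :
    matProb μ {M | ∀ j, (M - lam j • (1 : Matrix (Fin n) (Fin n) F)).det = 0} ≤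
      (((Fintype.card F : ℝ) - 1)⁻¹) ^ m * ∑ V ∈ Finset.univ.filter
        (fun V : Fin n → Fin m → F => ∀ ξ, ξ ≠ 0 → ∃ i, ξ ⬝ᵥ V i ≠ 0),
        ∏ c, ∑ x ∈ Finset.univ.filter
          (fun x : Fin n → F => ∑ i, x i • V i = fun j => lam j * V c j), ∏ i, μ i c (x i) := by
  have hq : (0 : ℝ) < (Fintype.card F : ℝ) - 1 := by
    have := Fintype.one_lt_card (α := F)
    rw [sub_pos]; exact_mod_cast this
  have hW : ∀ M : Matrix (Fin n) (Fin n) F, 0 ≤ ∏ i, ∏ j, μ i j (M i j) := fun M =>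
    Finset.prod_nonneg fun i _ => Finset.prod_nonneg fun j _ => hμ i j _
  rw [inv_pow, inv_mul_eq_div, le_div_iff₀ (pow_pos hq m)]
  have hP : ∀ V : Fin n → Fin m → F, ∏ c, ∑ x ∈ Finset.univ.filter
      (fun x : Fin n → F => ∑ i, x i • V i = fun j => lam j * V c j), ∏ i, μ i c (x i) =
      ∑ M : Matrix (Fin n) (Fin n) F, if ∀ c, ∑ i, M i c • V i = fun j => lam j * V c j then
        ∏ i, ∏ j, μ i j (M i j) else 0 := fun V => by
    rw [← matProb_forall_column μ (fun c x => ∑ i, x i • V i = fun j => lam j * V c j), matProb,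
      Finset.sum_filter]
    exact Finset.sum_congr rfl fun M _ => by congr!
  rw [Finset.sum_congr rfl fun V _ => hP V, Finset.sum_comm, matProb, Finset.sum_mul]
  refine (Finset.sum_le_sum fun M hM => ?_).trans (Finset.sum_le_sum_of_subset_of_nonneg
    (Finset.subset_univ _) fun M _ _ => Finset.sum_nonneg fun V _ => ?_)
  · rw [← Finset.sum_filter, Finset.sum_const, nsmul_eq_mul, mul_comm, Finset.filter_filter]
    refine mul_le_mul_of_nonneg_right ?_ (hW M)
    have h1 := pow_le_card_eigenvectors hlam (M := M) (by simpa using hM)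
    have h2 : ((Fintype.card F - 1 : ℕ) : ℝ) = (Fintype.card F : ℝ) - 1 := by
      rw [Nat.cast_sub Fintype.card_pos, Nat.cast_one]
    rw [← h2]
    exact_mod_cast h1
  · split_ifs
    exacts [hW M, le_rfl]

/-- The probability that all `lam j` are eigenvalues is controlled by a moment of the spectral sums
of the columns. -/
lemma matProb_eigenvalues_le_of_moment (hψ : ψ.IsPrimitive) (hn : n ≠ 0)
    {μ : Fin n → Fin n → F → ℝ} (hμ : ∀ i j a, 0 ≤ μ i j a) {lam : Fin m → F}
    (hlam : Function.Injective lam) {B : ℝ}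
    (hB : ∀ c, ∑ V ∈ Finset.univ.filter
      (fun V : Fin n → Fin m → F => ∀ ξ, ξ ≠ 0 → ∃ i, ξ ⬝ᵥ V i ≠ 0),
        (spectralSum ψ (fun i => μ i c) V / Fintype.card (Fin m → F)) ^ n ≤ B) :
    matProb μ {M | ∀ j, (M - lam j • (1 : Matrix (Fin n) (Fin n) F)).det = 0} ≤
      (((Fintype.card F : ℝ) - 1)⁻¹) ^ m * B := by
  have hq : (0 : ℝ) ≤ (Fintype.card F : ℝ) - 1 := by
    rw [sub_nonneg]; exact_mod_cast Fintype.card_pos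
  have hn' : (0 : ℝ) < n := by exact_mod_cast Nat.pos_of_ne_zero hn
  refine (matProb_eigenvalues_le hμ hlam).trans (mul_le_mul_of_nonneg_left ?_ (by positivity))
  have hS : ∀ c (V : Fin n → Fin m → F),
      0 ≤ spectralSum ψ (fun i => μ i c) V / Fintype.card (Fin m → F) := fun c V =>
    div_nonneg (Finset.sum_nonneg fun ξ _ => Finset.prod_nonneg fun i _ => norm_nonneg _)
      (Nat.cast_nonneg _)
  have hAG : ∀ V : Fin n → Fin m → F, ∏ c, ∑ x ∈ Finset.univ.filter
      (fun x : Fin n → F => ∑ i, x i • V i = fun j => lam j * V c j), ∏ i, μ i c (x i) ≤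
      ∑ c, (n : ℝ)⁻¹ * (spectralSum ψ (fun i => μ i c) V / Fintype.card (Fin m → F)) ^ n := by
    intro V
    refine (Finset.prod_le_prod (fun c _ => Finset.sum_nonneg fun x _ => Finset.prod_nonneg
      fun i _ => hμ i c _) fun c _ => sum_filter_prod_le_spectralSum hψ (fun i => μ i c)
      (fun i => hμ i c) V _).trans ?_
    have h := Real.geom_mean_le_arith_mean_weighted Finset.univ (fun _ : Fin n => (n : ℝ)⁻¹)
      (fun c => (spectralSum ψ (fun i => μ i c) V / Fintype.card (Fin m → F)) ^ n)
      (fun _ _ => by positivity) (by simp [hn]) (fun c _ => pow_nonneg (hS c V) n)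
    simpa only [Real.pow_rpow_inv_natCast (hS _ V) hn] using h
  refine (Finset.sum_le_sum fun V _ => hAG V).trans ?_
  rw [Finset.sum_comm]
  simp only [← Finset.mul_sum]
  rw [Finset.mul_sum]
  refine (Finset.sum_le_sum fun c _ => mul_le_mul_of_nonneg_left (hB c)
    (by positivity : (0 : ℝ) ≤ (n : ℝ)⁻¹)).trans (le_of_eq ?_)
  rw [Finset.sum_const, Finset.card_univ, Fintype.card_fin, nsmul_eq_mul]
  field_simp

lemma one_sub_pow_le_exp {x : ℝ} (hx : x ≤ 1) (n : ℕ) : (1 - x) ^ n ≤ Real.exp (-(n * x)) := by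
  rw [← mul_neg, Real.exp_nat_mul]
  exact pow_le_pow_left₀ (by linarith) (Real.one_sub_le_exp_neg x) n

/-- Numerical estimate for the error terms of the moment bound. -/
lemma exists_error_bound (hα0 : 0 < α) (hα1 : α < 1) (hn : 1 ≤ n) {N : ℝ} (hN : 16 / α ≤ N)
    (hlogN : Real.log N ≤ α ^ 2 / 10 ^ 8 * Real.sqrt n) :
    ∃ k : ℕ, n * N * Real.exp (-(α / 4) * k) ≤ α / 8 ∧
      n * Real.exp (n * (α / 16)) * (N * (1 - α / 2) ^ n) +
          N ^ k * ((1 - α / 8) ^ n * Real.exp (k * (4 ^ 8 * (4 * Real.log N)))) ≤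
        (16 / α + 1) * Real.exp (-(α ^ 2 / 10 ^ 8 * Real.sqrt n)) := by
  have hn1 : (1 : ℝ) ≤ n := by exact_mod_cast hn
  have hN16 : 16 ≤ N := le_trans (by rw [le_div_iff₀ hα0]; linarith) hN
  have hN0 : 0 < N := by linarith
  have hNinv : N⁻¹ ≤ α / 16 := by
    rw [inv_le_comm₀ hN0 (by positivity), inv_div]; exact hN
  set g := Real.log N with hg
  have hg0 : 0 ≤ g := Real.log_nonneg (by linarith)
  have hNg : N = Real.exp g := (Real.exp_log hN0).symm
  set s := Real.sqrt n with hs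
  have hs2 : s * s = n := Real.mul_self_sqrt (by linarith)
  have hs1 : 1 ≤ s := Real.one_le_sqrt.2 hn1
  set c := α ^ 2 / 10 ^ 8 with hc
  have hc0 : 0 < c := by positivity
  have hcα : c ≤ α / 10 ^ 8 := by
    rw [hc]; gcongr; nlinarith
  have hlogn : Real.log n ≤ 2 * s := by
    rw [← hs2, Real.log_mul (by positivity) (by positivity)]
    have := Real.log_le_sub_one_of_pos (show 0 < s by linarith)
    linarith
  have hlogn0 : 0 ≤ Real.log n := Real.log_nonneg hn1
  have hsn : c * s ≤ c * n := by rw [← hs2]; gcongr; nlinarith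
  set k := ⌈4 / α * (Real.log n + 2 * g)⌉₊ with hk
  have hk1 : 4 / α * (Real.log n + 2 * g) ≤ k := Nat.le_ceil _
  have hk2 : (k : ℝ) ≤ 17 / α * s := by
    have h1 := (Nat.ceil_lt_add_one (a := 4 / α * (Real.log n + 2 * g)) (by positivity)).le
    have h2 : Real.log n + 2 * g ≤ 4 * s := by nlinarith
    have h3 : 4 / α * (Real.log n + 2 * g) ≤ 4 / α * (4 * s) := by gcongr
    have h4 : 1 ≤ 1 / α * s := by
      rw [one_div_mul_eq_div, le_div_iff₀ hα0]; linarith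
    calc (k : ℝ) ≤ 4 / α * (4 * s) + 1 / α * s := by linarith
      _ = 17 / α * s := by ring
  refine ⟨k, ?_, ?_⟩
  · have h1 : Real.exp (-(α / 4) * k) ≤ Real.exp (-(Real.log n + 2 * g)) := by
      rw [Real.exp_le_exp]
      have : α / 4 * (4 / α * (Real.log n + 2 * g)) ≤ α / 4 * k := by gcongr
      have h : α / 4 * (4 / α * (Real.log n + 2 * g)) = Real.log n + 2 * g := by field_simp
      linarith
    calc n * N * Real.exp (-(α / 4) * k) ≤ n * N * Real.exp (-(Real.log n + 2 * g)) := by gcongr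
      _ = N⁻¹ := by
          rw [neg_add, Real.exp_add, Real.exp_neg, Real.exp_log (by linarith), Real.exp_neg,
            two_mul, Real.exp_add, ← hNg]
          field_simp
      _ ≤ α / 8 := by linarith
  · have h1 : n * Real.exp (n * (α / 16)) * (N * (1 - α / 2) ^ n) ≤
        16 / α * Real.exp (-(c * s)) := by
      have h2 : (n : ℝ) ≤ 16 / α * Real.exp (n * (α / 16)) := by
        have := Real.add_one_le_exp (n * (α / 16))
        calc (n : ℝ) = 16 / α * (n * (α / 16)) := by field_simp
          _ ≤ _ := by gcongr; linarith
      calc n * Real.exp (n * (α / 16)) * (N * (1 - α / 2) ^ n)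
          ≤ 16 / α * Real.exp (n * (α / 16)) * Real.exp (n * (α / 16)) *
            (Real.exp g * Real.exp (-(n * (α / 2)))) := by
              rw [← hNg]
              have := one_sub_pow_le_exp (x := α / 2) (by linarith) n
              have h0 : 0 ≤ N * (1 - α / 2) ^ n :=
                mul_nonneg hN0.le (pow_nonneg (by linarith) n)
              gcongr
        _ = 16 / α * Real.exp (n * (α / 16) + n * (α / 16) + (g + -(n * (α / 2)))) := by
              simp only [Real.exp_add]; ring
        _ ≤ _ := by
              gcongr
              nlinarith
    have h2 : N ^ k * ((1 - α / 8) ^ n * Real.exp (k * (4 ^ 8 * (4 * g)))) ≤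
        Real.exp (-(c * s)) := by
      have h3 : k * g ≤ 17 * α / 10 ^ 8 * n := by
        calc k * g ≤ 17 / α * s * (c * s) := by gcongr
          _ = 17 * α / 10 ^ 8 * n := by rw [← hs2, hc]; field_simp
      calc N ^ k * ((1 - α / 8) ^ n * Real.exp (k * (4 ^ 8 * (4 * g))))
          ≤ Real.exp g ^ k * (Real.exp (-(n * (α / 8))) * Real.exp (k * (4 ^ 8 * (4 * g)))) := by
              rw [← hNg]
              have := one_sub_pow_le_exp (x := α / 8) (by linarith) n
              gcongr
        _ = Real.exp (k * g + (-(n * (α / 8)) + k * (4 ^ 8 * (4 * g)))) := by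
              rw [← Real.exp_nat_mul]; simp only [Real.exp_add]
        _ ≤ _ := by
              gcongr
              nlinarith
    linarith

end RandomMatrix

theorem stmt3 (α : ℝ) (hα0 : 0 < α) (hα1 : α < 1) :
    ∃ c C₀ C : ℝ, 0 < c ∧ 0 < C₀ ∧ 0 < C ∧
      ∀ (F : Type) [Field F] [Fintype F], ∀ n m : ℕ, 1 ≤ n → 1 ≤ m →
        (m : ℝ) < c * Real.log n →
        C₀ ≤ Real.log (Fintype.card F) →
        Real.log (Fintype.card F) < c * Real.sqrt (α * n) / (m : ℝ) ^ ((3 : ℝ) / 2) →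
        ∀ μ : Fin n → Fin n → F → ℝ, (∀ i j, IsBalanced α (μ i j)) →
        ∀ lam : Fin m → F, Function.Injective lam →
          matProb μ {M : Matrix (Fin n) (Fin n) F |
              ∀ j : Fin m, (M - lam j • (1 : Matrix (Fin n) (Fin n) F)).det = 0} ≤
            (((Fintype.card F : ℝ) - 1)⁻¹) ^ m +
              C * Real.exp (-(c * Real.sqrt (α * n) / (m : ℝ) ^ ((3 : ℝ) / 2))) := by
  refine ⟨α ^ 2 / 10 ^ 8, Real.log (16 / α), 16 / α + 1, by positivity,
    Real.log_pos (by rw [lt_div_iff₀ hα0]; linarith), by positivity, ?_⟩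
  intro F _ _ n m hn hm _ hC₀ hlog μ hμ lam hlam
  set c := α ^ 2 / 10 ^ 8
  have hc0 : 0 < c := by positivity
  have hm1 : (1 : ℝ) ≤ m := by exact_mod_cast hm
  have hq2 : (2 : ℝ) ≤ Fintype.card F := by exact_mod_cast Fintype.one_lt_card (α := F)
  have hαn : Real.sqrt (α * n) ≤ Real.sqrt n :=
    Real.sqrt_le_sqrt (mul_le_of_le_one_left (Nat.cast_nonneg n) hα1.le)
  have hmpow : (m : ℝ) ≤ (m : ℝ) ^ ((3 : ℝ) / 2) := by
    simpa using Real.rpow_le_rpow_of_exponent_le hm1 (show (1 : ℝ) ≤ 3 / 2 by norm_num)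
  have hm0 : (0 : ℝ) < (m : ℝ) ^ ((3 : ℝ) / 2) := by linarith
  have hD : c * Real.sqrt (α * n) / (m : ℝ) ^ ((3 : ℝ) / 2) ≤ c * Real.sqrt n :=
    (div_le_self (by positivity) (hm1.trans hmpow)).trans (by gcongr)
  have hcardN : (Fintype.card (Fin m → F) : ℝ) = (Fintype.card F : ℝ) ^ m := by
    rw [Fintype.card_fun, Fintype.card_fin]; push_cast; rfl
  have hN : 16 / α ≤ Fintype.card (Fin m → F) := by
    rw [hcardN]
    exact ((Real.log_le_log_iff (by positivity) (by linarith)).1 hC₀).trans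
      (le_self_pow₀ (by linarith) (by omega))
  have hlogN : Real.log (Fintype.card (Fin m → F)) ≤ c * Real.sqrt n := by
    rw [hcardN, Real.log_pow]
    have h0 : 0 ≤ Real.log (Fintype.card F) := Real.log_nonneg (by linarith)
    calc m * Real.log (Fintype.card F)
        ≤ (m : ℝ) ^ ((3 : ℝ) / 2) * Real.log (Fintype.card F) := by gcongr
      _ ≤ c * Real.sqrt (α * n) := by
        rw [mul_comm]; exact ((lt_div_iff₀ hm0).1 hlog).le
      _ ≤ c * Real.sqrt n := by gcongr
  obtain ⟨k, hk, herr⟩ := RandomMatrix.exists_error_bound hα0 hα1 hn hN hlogN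
  obtain ⟨ψ, hψ1⟩ := AddChar.exists_apply_ne_zero.2 (one_ne_zero (α := F))
  have hψ : ψ.IsPrimitive := AddChar.IsPrimitive.of_ne_one fun h => hψ1 (by simp [h])
  have hmain := RandomMatrix.matProb_eigenvalues_le_of_moment hψ (by omega)
    (fun i j => (hμ i j).1) hlam fun l =>
      RandomMatrix.sum_pow_spectralSum_le hα0 hα1 hψ (fun i => hμ i l) hN hk
  refine hmain.trans ?_
  have hp1 : (((Fintype.card F : ℝ) - 1)⁻¹) ^ m ≤ 1 :=
    pow_le_one₀ (inv_nonneg.2 (by linarith)) (inv_le_one_of_one_le₀ (by linarith))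
  have hp0 : 0 ≤ (((Fintype.card F : ℝ) - 1)⁻¹) ^ m :=
    pow_nonneg (inv_nonneg.2 (by linarith)) m
  have hexp : (16 / α + 1) * Real.exp (-(c * Real.sqrt n)) ≤ (16 / α + 1) *
      Real.exp (-(c * Real.sqrt (α * n) / (m : ℝ) ^ ((3 : ℝ) / 2))) := by gcongr
  have hE0 : 0 ≤ (16 / α + 1) * Real.exp (-(c * Real.sqrt (α * n) / (m : ℝ) ^ ((3 : ℝ) / 2))) := by
    positivity
  rw [add_assoc, mul_add, mul_one]
  refine add_le_add le_rfl ((mul_le_mul_of_nonneg_left (herr.trans hexp) hp0).trans ?_)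
  exact mul_le_of_le_one_left hE0 hp1
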